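/- arXiv:2602.21685 — 2 statements merged into one kernel-verified Lean document; each statement's English description precedes it below -/
import Mathlib

section
/- Let ℓ > 0 and define the one-dimensional fourth-order AT2 optimal phase-field profile d : ℝ → ℝ by d(x) = (1 + 2|x|/ℓ) exp(−2|x|/ℓ). Then the fourth-order AT2 regularized crack surface density is normalized to one: (1/(2ℓ)) ∫_ℝ ( d(x)² + (ℓ²/2) (d′(x))² + (ℓ⁴/16) (d″(x))² ) dx = 1. -/
open MeasureTheory

/-- The profile `(1 + 2|x|/ℓ) exp (-2|x|/ℓ)` has derivative `-(4x/ℓ²) exp (-2|x|/ℓ)` off the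
crack. -/
theorem hasDerivAt_profile {ℓ x : ℝ} (hℓ : 0 < ℓ) (hx : x ≠ 0) :
    HasDerivAt (fun y : ℝ => (1 + 2 * |y| / ℓ) * Real.exp (-2 * |y| / ℓ))
      (-(4 * x / ℓ ^ 2) * Real.exp (-2 * |x| / ℓ)) x := by
  have habs := hasDerivAt_abs hx
  have h := (((habs.const_mul 2).div_const ℓ).const_add 1).mul
    ((habs.const_mul (-2)).div_const ℓ).exp
  refine h.congr_deriv ?_
  rcases hx.lt_or_gt with hneg | hpos
  · simp only [sign_neg hneg, abs_of_neg hneg, SignType.coe_neg_one]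
    field_simp
    ring
  · simp only [sign_pos hpos, abs_of_pos hpos, SignType.coe_one]
    field_simp
    ring

/-- The derivative of the profile has derivative `(4/ℓ²)(2|x|/ℓ - 1) exp (-2|x|/ℓ)` off the
crack. -/
theorem hasDerivAt_deriv_profile {ℓ x : ℝ} (hℓ : 0 < ℓ) (hx : x ≠ 0) :
    HasDerivAt (deriv (fun y : ℝ => (1 + 2 * |y| / ℓ) * Real.exp (-2 * |y| / ℓ)))
      (4 / ℓ ^ 2 * (2 * |x| / ℓ - 1) * Real.exp (-2 * |x| / ℓ)) x := by
  have heq : deriv (fun y : ℝ => (1 + 2 * |y| / ℓ) * Real.exp (-2 * |y| / ℓ))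
      =ᶠ[nhds x] fun y => -(4 * y / ℓ ^ 2) * Real.exp (-2 * |y| / ℓ) := by
    filter_upwards [isOpen_ne.mem_nhds hx] with y hy
    exact (hasDerivAt_profile hℓ hy).deriv
  refine HasDerivAt.congr_of_eventuallyEq ?_ heq
  have h := ((((hasDerivAt_id x).const_mul 4).div_const (ℓ ^ 2)).neg).mul
    (((hasDerivAt_abs hx).const_mul (-2)).div_const ℓ).exp
  refine h.congr_deriv ?_
  rcases hx.lt_or_gt with hneg | hpos
  · simp only [sign_neg hneg, abs_of_neg hneg, SignType.coe_neg_one, Pi.neg_apply, id]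
    field_simp
    ring
  · simp only [sign_pos hpos, abs_of_pos hpos, SignType.coe_one, Pi.neg_apply, id]
    field_simp
    ring

theorem integral_Ioi_two_add_sq_mul_exp_neg :
    ∫ s in Set.Ioi (0 : ℝ), (2 + s ^ 2) * Real.exp (-s) = 4 := by
  have hderiv (s : ℝ) : HasDerivAt (fun s : ℝ => -((s ^ 2 + 2 * s + 4) * Real.exp (-s)))
      ((2 + s ^ 2) * Real.exp (-s)) s := by
    have h := (((((hasDerivAt_id s).pow 2).add ((hasDerivAt_id s).const_mul 2)).add_const 4).mul
      (hasDerivAt_id s).neg.exp).neg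
    refine h.congr_deriv ?_
    simp
    ring
  have hlim : Filter.Tendsto (fun s : ℝ => -((s ^ 2 + 2 * s + 4) * Real.exp (-s)))
      Filter.atTop (nhds 0) := by
    have h := (((Real.tendsto_pow_mul_exp_neg_atTop_nhds_zero 2).add
      ((Real.tendsto_pow_mul_exp_neg_atTop_nhds_zero 1).const_mul 2)).add
      ((Real.tendsto_pow_mul_exp_neg_atTop_nhds_zero 0).const_mul 4)).neg
    simp only [mul_zero, add_zero, neg_zero] at h
    refine h.congr fun s => ?_
    ring
  have h := integral_Ioi_of_hasDerivAt_of_nonneg' (a := 0) (fun s _ => hderiv s)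
    (fun s _ => by positivity) hlim
  rw [h]
  norm_num

/-- Normalization of the fourth-order AT2 regularized crack surface density:
for the one-dimensional optimal profile `d x = (1 + 2|x|/ℓ) * exp (-2|x|/ℓ)`,
`(1/(2ℓ)) ∫ (d² + (ℓ²/2)(d')² + (ℓ⁴/16)(d'')²) = 1`. -/
theorem at2_fourth_order_normalization (ℓ : ℝ) (hℓ : 0 < ℓ) :
    (1 / (2 * ℓ)) *
      ∫ x : ℝ,
        (((1 + 2 * |x| / ℓ) * Real.exp (-2 * |x| / ℓ)) ^ 2 +
          (ℓ ^ 2 / 2) *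
            (deriv (fun y : ℝ => (1 + 2 * |y| / ℓ) * Real.exp (-2 * |y| / ℓ)) x) ^ 2 +
          (ℓ ^ 4 / 16) *
            (deriv (deriv (fun y : ℝ => (1 + 2 * |y| / ℓ) * Real.exp (-2 * |y| / ℓ))) x) ^ 2)
      = 1 := by
  have hae : ∀ᵐ x : ℝ, x ≠ 0 := by simp [ae_iff]
  have hint : ∀ᵐ x : ℝ,
      ((1 + 2 * |x| / ℓ) * Real.exp (-2 * |x| / ℓ)) ^ 2 +
          (ℓ ^ 2 / 2) *
            (deriv (fun y : ℝ => (1 + 2 * |y| / ℓ) * Real.exp (-2 * |y| / ℓ)) x) ^ 2 +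
          (ℓ ^ 4 / 16) *
            (deriv (deriv (fun y : ℝ => (1 + 2 * |y| / ℓ) * Real.exp (-2 * |y| / ℓ))) x) ^ 2
        = (2 + (4 / ℓ * |x|) ^ 2) * Real.exp (-(4 / ℓ * |x|)) := by
    filter_upwards [hae] with x hx
    have hexp : Real.exp (-(4 / ℓ * |x|)) = Real.exp (-2 * |x| / ℓ) ^ 2 := by
      rw [← Real.exp_nat_mul]
      congr 1
      push_cast
      ring
    rw [(hasDerivAt_profile hℓ hx).deriv, (hasDerivAt_deriv_profile hℓ hx).deriv, hexp]
    generalize Real.exp (-2 * |x| / ℓ) = E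
    rw [mul_pow (-(4 * x / ℓ ^ 2)), neg_sq, div_pow, mul_pow 4 x, ← sq_abs x]
    field_simp
    ring
  rw [integral_congr_ae hint,
    integral_comp_abs (f := fun s => (2 + (4 / ℓ * s) ^ 2) * Real.exp (-(4 / ℓ * s))),
    integral_comp_mul_left_Ioi (fun s => (2 + s ^ 2) * Real.exp (-s)) 0 (by positivity : 0 < 4 / ℓ),
    mul_zero, integral_Ioi_two_add_sq_mul_exp_neg, smul_eq_mul]
  field_simp
end

section
/- Let ℓ > 0 and d(x) = (1 + 2|x|/ℓ) exp(−2|x|/ℓ). Then d is continuously differentiable on all of ℝ with d′(0) = 0 and d(0) = 1, and on (0, ∞) it satisfies the fourth-order Euler–Lagrange equation of the fourth-order AT2 crack density functional: d(x) − (ℓ²/2) d″(x) + (ℓ⁴/16) d⁗(x) = 0 for all x > 0. -/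
theorem hasDerivAt_affine_mul_exp (a b c x : ℝ) :
    HasDerivAt (fun y : ℝ => (a + b * y) * Real.exp (c * y))
      (((b + c * a) + c * b * x) * Real.exp (c * x)) x := by
  have h₁ : HasDerivAt (fun y : ℝ => a + b * y) b x := by
    simpa using ((hasDerivAt_id x).const_mul b).const_add a
  have h₂ : HasDerivAt (fun y : ℝ => Real.exp (c * y)) (Real.exp (c * x) * c) x := by
    simpa using ((hasDerivAt_id x).const_mul c).exp
  exact (h₁.mul h₂).congr_deriv (by ring)

theorem deriv_affine_mul_exp (a b c : ℝ) :
    deriv (fun y : ℝ => (a + b * y) * Real.exp (c * y)) =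
      fun y => ((b + c * a) + c * b * y) * Real.exp (c * y) :=
  funext fun x => (hasDerivAt_affine_mul_exp a b c x).deriv

/-- The profile `(1 + 2|x|/ℓ) * exp (-2|x|/ℓ)` is differentiable everywhere, including at the
crack location `x = 0`. -/
theorem hasDerivAt_fourth_order_profile (ℓ x : ℝ) :
    HasDerivAt (fun y : ℝ => (1 + 2 * |y| / ℓ) * Real.exp (-2 * |y| / ℓ))
      (-(2 / ℓ) ^ 2 * x * Real.exp (-2 * |x| / ℓ)) x := by
  have right (y : ℝ) (hy : 0 ≤ y) : (1 + 2 * |y| / ℓ) * Real.exp (-2 * |y| / ℓ) =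
      (1 + 2 / ℓ * y) * Real.exp (-(2 / ℓ) * y) := by
    rw [abs_of_nonneg hy]; ring_nf
  have left (y : ℝ) (hy : y ≤ 0) : (1 + 2 * |y| / ℓ) * Real.exp (-2 * |y| / ℓ) =
      (1 + -(2 / ℓ) * y) * Real.exp (2 / ℓ * y) := by
    rw [abs_of_nonpos hy]; ring_nf
  rcases lt_trichotomy x 0 with hx | rfl | hx
  · refine ((hasDerivAt_affine_mul_exp 1 (-(2 / ℓ)) (2 / ℓ) x).congr_of_eventuallyEq
      ?_).congr_deriv ?_
    · filter_upwards [Iio_mem_nhds hx] with y hy using left y (le_of_lt hy)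
    · rw [abs_of_neg hx]; ring_nf
  · rw [← hasDerivWithinAt_univ, ← Set.Iic_union_Ici (a := (0 : ℝ))]
    refine HasDerivWithinAt.union ?_ ?_
    · exact ((hasDerivAt_affine_mul_exp 1 (-(2 / ℓ)) (2 / ℓ) 0).hasDerivWithinAt.congr
        left (left 0 le_rfl)).congr_deriv (by simp)
    · exact ((hasDerivAt_affine_mul_exp 1 (2 / ℓ) (-(2 / ℓ)) 0).hasDerivWithinAt.congr
        right (right 0 le_rfl)).congr_deriv (by simp)
  · refine ((hasDerivAt_affine_mul_exp 1 (2 / ℓ) (-(2 / ℓ)) x).congr_of_eventuallyEq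
      ?_).congr_deriv ?_
    · filter_upwards [Ioi_mem_nhds hx] with y hy using right y (le_of_lt hy)
    · rw [abs_of_pos hx]; ring_nf

/-- The fourth-order AT2 optimal profile `d x = (1 + 2|x|/ℓ) * exp (-2|x|/ℓ)` is
continuously differentiable on all of `ℝ` with `d' 0 = 0` and `d 0 = 1`, and on
`(0, ∞)` it satisfies the fourth-order Euler–Lagrange equation
`d - (ℓ²/2) d'' + (ℓ⁴/16) d'''' = 0`. -/
theorem at2_fourth_order_profile_euler_lagrange (ℓ : ℝ) (hℓ : 0 < ℓ) :
    ContDiff ℝ 1 (fun x : ℝ => (1 + 2 * |x| / ℓ) * Real.exp (-2 * |x| / ℓ)) ∧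
    deriv (fun x : ℝ => (1 + 2 * |x| / ℓ) * Real.exp (-2 * |x| / ℓ)) 0 = 0 ∧
    (fun x : ℝ => (1 + 2 * |x| / ℓ) * Real.exp (-2 * |x| / ℓ)) 0 = 1 ∧
    (∀ x : ℝ, 0 < x →
      (1 + 2 * |x| / ℓ) * Real.exp (-2 * |x| / ℓ) -
        (ℓ ^ 2 / 2) *
          iteratedDeriv 2 (fun y : ℝ => (1 + 2 * |y| / ℓ) * Real.exp (-2 * |y| / ℓ)) x +
        (ℓ ^ 4 / 16) *
          iteratedDeriv 4 (fun y : ℝ => (1 + 2 * |y| / ℓ) * Real.exp (-2 * |y| / ℓ)) x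
      = 0) := by
  have hderiv := hasDerivAt_fourth_order_profile ℓ
  refine ⟨?_, ?_, by simp, fun x hx => ?_⟩
  · rw [contDiff_one_iff_deriv]
    refine ⟨fun x => (hderiv x).differentiableAt, ?_⟩
    rw [funext fun x => (hderiv x).deriv]
    fun_prop
  · simpa using (hderiv 0).deriv
  · have heq : (fun y : ℝ => (1 + 2 * |y| / ℓ) * Real.exp (-2 * |y| / ℓ)) =ᶠ[nhds x]
        fun y => (1 + 2 / ℓ * y) * Real.exp (-(2 / ℓ) * y) := by
      filter_upwards [Ioi_mem_nhds hx] with y hy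
      rw [abs_of_pos hy]
      ring_nf
    rw [heq.iteratedDeriv_eq, heq.iteratedDeriv_eq, heq.eq_of_nhds]
    simp only [iteratedDeriv_succ', iteratedDeriv_zero, deriv_affine_mul_exp]
    field_simp
    ring
end
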